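/- Let k ≥ 4 and let G be a k-critical graph on n vertices. Then t_{k-1}(G) ≤ n, and equality holds only if n = k and G is isomorphic to the complete graph K_n. -/

import Mathlib

open SimpleGraph

/-- The number of copies of the clique `K_ℓ` in `G`: the number of `ℓ`-element
vertex subsets inducing a complete subgraph. -/
noncomputable def cliqueCount {V : Type*} (G : SimpleGraph V) (ℓ : ℕ) : ℕ :=
  {s : Finset V | G.IsNClique ℓ s}.ncard

/-- `G` is `k`-critical: its chromatic number is `k`, but every proper subgraph
has chromatic number less than `k`. -/
def IsCritical {V : Type*} (G : SimpleGraph V) (k : ℕ) : Prop :=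
  G.chromaticNumber = k ∧ ∀ H : G.Subgraph, H ≠ ⊤ → H.coe.chromaticNumber < k

open Finset in
/-- In a set system of `m`-sets (with `0 < m`) such that every pair contained in a member is
distinguished by some set `A`, the indicator vectors of the members are linearly independent. -/
theorem linearIndependent_indicator_of_pair_distinguished {V : Type*} [Fintype V] [DecidableEq V]
    {m : ℕ} (hm : 0 < m) (𝒯 : Finset (Finset V)) (hcard : ∀ T ∈ 𝒯, #T = m)
    (hA : ∀ T ∈ 𝒯, ∀ x ∈ T, ∀ y ∈ T, x ≠ y → ∃ A : Finset V, ∀ T ∈ 𝒯,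
      #(T ∩ A) = 1 + if x ∈ T ∧ y ∈ T then 1 else 0) :
    LinearIndependent ℚ (fun (T : 𝒯) (v : V) => if v ∈ T.1 then (1 : ℚ) else 0) := by
  rw [Fintype.linearIndependent_iff]
  intro c hc
  have hsum_vertex (v : V) : ∑ T : 𝒯, (if v ∈ T.1 then c T else 0) = 0 := by
    simpa [Finset.sum_apply] using congrFun hc v
  have hsum (S : Finset V) : ∑ T : 𝒯, (if S ⊆ T.1 then c T else 0) = 0 := by
    induction h : #S using Nat.strong_induction_on generalizing S with
    | _ s ih =>
    subst h
    obtain hS | ⟨⟨T₀, hT₀⟩, hST₀⟩ : (∀ T : 𝒯, ¬ S ⊆ T.1) ∨ ∃ T : 𝒯, S ⊆ T.1 := by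
      by_cases h : ∃ T : 𝒯, S ⊆ T.1
      · exact Or.inr h
      · exact Or.inl (not_exists.mp h)
    · simp [hS]
    obtain hS | hS | hS : #S = 0 ∨ #S = 1 ∨ 1 < #S := by omega
    · obtain rfl := card_eq_zero.mp hS
      have h : (m : ℚ) * ∑ T : 𝒯, c T = 0 := by
        calc (m : ℚ) * ∑ T : 𝒯, c T = ∑ T : 𝒯, ∑ v : V, (if v ∈ T.1 then c T else 0) := by
              rw [mul_sum]
              refine sum_congr rfl fun T _ => ?_
              simp [hcard T.1 T.2]
          _ = 0 := by
              rw [sum_comm]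
              exact sum_eq_zero fun v _ => hsum_vertex v
      simpa [hm.ne'] using h
    · obtain ⟨v, rfl⟩ := card_eq_one.mp hS
      simpa using hsum_vertex v
    · obtain ⟨x, hx, y, hy, hxy⟩ := one_lt_card.mp hS
      obtain ⟨A, hA⟩ := hA T₀ hT₀ x (hST₀ hx) y (hST₀ hy) hxy
      set R := (S.erase x).erase y with hR
      have hRcard : #R + 2 = #S := by
        rw [hR, card_erase_of_mem (mem_erase.mpr ⟨hxy.symm, hy⟩), card_erase_of_mem hx]
        omega
      have hRS (T : Finset V) : S ⊆ T ↔ R ⊆ T ∧ x ∈ T ∧ y ∈ T := by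
        constructor
        · exact fun h => ⟨((erase_subset _ _).trans (erase_subset _ _)).trans h, h hx, h hy⟩
        · rintro ⟨h, hxT, hyT⟩ v hv
          by_cases hvx : v = x
          · exact hvx ▸ hxT
          by_cases hvy : v = y
          · exact hvy ▸ hyT
          exact h (by simp [hR, hv, hvx, hvy])
      have hinsert (u : V) : ∑ T : 𝒯, (if insert u R ⊆ T.1 then c T else 0) = 0 :=
        ih _ (by have := card_insert_le u R; omega) _ rfl
      have hcount : ∑ T : 𝒯, (if R ⊆ T.1 then c T * #(T.1 ∩ A) else 0) = 0 := by
        calc _ = ∑ T : 𝒯, ∑ u ∈ A, (if insert u R ⊆ T.1 then c T else 0) := by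
              refine sum_congr rfl fun T _ => ?_
              simp only [insert_subset_iff]
              by_cases h : R ⊆ T.1
              · simp only [h, and_true, if_true]
                rw [← sum_filter, sum_const, filter_mem_eq_inter, inter_comm, nsmul_eq_mul,
                  mul_comm]
              · simp [h]
          _ = 0 := by
              rw [sum_comm]
              exact sum_eq_zero fun u _ => hinsert u
      have hRsum := ih _ (by omega) R rfl
      calc _ = ∑ T : 𝒯, ((if R ⊆ T.1 then c T * #(T.1 ∩ A) else 0) -
            if R ⊆ T.1 then c T else 0) := by
              refine sum_congr rfl fun T _ => ?_
              rw [hA T.1 T.2]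
              simp only [hRS]
              by_cases hRT : R ⊆ T.1 <;> by_cases hxyT : x ∈ T.1 ∧ y ∈ T.1 <;>
                simp only [hRT, hxyT] <;> norm_num
              ring
        _ = 0 := by rw [sum_sub_distrib, hcount, hRsum, sub_zero]
  intro T₀
  have h := hsum T₀.1
  rw [sum_eq_single T₀] at h
  · simpa using h
  · intro T _ hT
    rw [if_neg fun hsub => hT (Subtype.ext (eq_of_subset_of_card_le hsub ?_).symm)]
    rw [hcard _ T.2, hcard _ T₀.2]
  · simp

/-- Every proper subgraph of a `k`-critical graph is `(k - 1)`-colorable. -/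
theorem IsCritical.colorable_coe {V : Type*} {G : SimpleGraph V} {k : ℕ} (hG : IsCritical G k)
    {H : G.Subgraph} (hH : H ≠ ⊤) : H.coe.Colorable (k - 1) := by
  have hlt := hG.2 H hH
  rw [← chromaticNumber_le_iff_colorable]
  obtain ⟨m, hm⟩ := ENat.ne_top_iff_exists.mp hlt.ne_top
  rw [← hm] at hlt ⊢
  norm_cast at hlt ⊢
  omega

theorem IsCritical.not_colorable {V : Type*} {G : SimpleGraph V} {k : ℕ} (hG : IsCritical G k)
    (hk : 0 < k) : ¬ G.Colorable (k - 1) := by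
  rw [← chromaticNumber_le_iff_colorable, hG.1]
  norm_cast
  omega

/-- Deleting the edge `xy` from a `k`-critical graph leaves a `(k - 1)`-coloring in which `x` and
`y` share a color. -/
theorem IsCritical.exists_coloring_deleteEdge {V : Type*} {G : SimpleGraph V} {k : ℕ}
    (hG : IsCritical G k) (hk : 0 < k) {x y : V} (hxy : G.Adj x y) :
    ∃ φ : V → Fin (k - 1), φ x = φ y ∧
      ∀ u v, G.Adj u v → φ u = φ v → s(u, v) = s(x, y) := by
  have hne : (⊤ : G.Subgraph).deleteEdges {s(x, y)} ≠ ⊤ := by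
    intro h
    have : ((⊤ : G.Subgraph).deleteEdges {s(x, y)}).Adj x y := by simpa [h] using hxy
    simp at this
  obtain ⟨φ⟩ := hG.colorable_coe hne
  have hφ (u v : V) (huv : G.Adj u v) (h : φ ⟨u, by simp⟩ = φ ⟨v, by simp⟩) :
      s(u, v) = s(x, y) := by
    by_contra hne
    refine φ.valid (v := ⟨u, by simp⟩) (w := ⟨v, by simp⟩) ?_ h
    simp only [Subgraph.coe_adj, Subgraph.deleteEdges_adj, Subgraph.top_adj]
    exact ⟨huv, by simpa using hne⟩
  refine ⟨fun v => φ ⟨v, by simp⟩, ?_, hφ⟩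
  by_contra hxy'
  refine hG.not_colorable hk ⟨Coloring.mk (fun v => φ ⟨v, by simp⟩) fun {u v} huv h => ?_⟩
  obtain ⟨rfl, rfl⟩ | ⟨rfl, rfl⟩ := Sym2.eq_iff.mp (hφ u v huv h)
  · exact hxy' h
  · exact hxy' h.symm

open Finset in
/-- For every edge `xy` of a `k`-critical graph there is a vertex set containing `x` and `y` that
meets each `(k - 1)`-clique in one vertex, or in two if the clique contains both `x` and `y`. -/
theorem IsCritical.exists_finset_card_inter {V : Type*} [Fintype V] [DecidableEq V]
    {G : SimpleGraph V} {k : ℕ} (hG : IsCritical G k) (hk : 0 < k) {x y : V} (hxy : G.Adj x y) :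
    ∃ A : Finset V, x ∈ A ∧ ∀ T, G.IsNClique (k - 1) T →
      #(T ∩ A) = 1 + if x ∈ T ∧ y ∈ T then 1 else 0 := by
  obtain ⟨φ, hφxy, hφ⟩ := hG.exists_coloring_deleteEdge hk hxy
  refine ⟨univ.filter fun v => φ v = φ x, by simp, fun T hT => ?_⟩
  split_ifs with h
  · have : T ∩ univ.filter (fun v => φ v = φ x) = {x, y} := by
      ext v
      simp only [mem_inter, mem_filter, mem_univ, true_and, mem_insert, mem_singleton]
      constructor
      · rintro ⟨hvT, hv⟩
        by_cases hvx : v = x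
        · exact Or.inl hvx
        have := hφ v x (hT.isClique hvT h.1 hvx) hv
        rw [Sym2.eq_iff] at this
        tauto
      · rintro (rfl | rfl)
        · exact ⟨h.1, rfl⟩
        · exact ⟨h.2, hφxy.symm⟩
    rw [this, card_pair hxy.ne]
  · have hinj : Set.InjOn φ T := by
      intro u hu v hv huv
      by_contra hne
      obtain ⟨rfl, rfl⟩ | ⟨rfl, rfl⟩ := Sym2.eq_iff.mp (hφ u v (hT.isClique hu hv hne) huv)
      · exact h ⟨hu, hv⟩
      · exact h ⟨hv, hu⟩
    have himage : T.image φ = univ := by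
      rw [← card_eq_iff_eq_univ, card_image_of_injOn hinj, hT.card_eq, Fintype.card_fin]
    obtain ⟨w, hwT, hw⟩ := mem_image.mp (himage ▸ mem_univ (φ x))
    rw [add_zero, card_eq_one]
    refine ⟨w, ?_⟩
    ext v
    simp only [mem_inter, mem_filter, mem_univ, true_and, mem_singleton]
    constructor
    · rintro ⟨hvT, hv⟩
      exact hinj hvT hwT (hv.trans hw.symm)
    · rintro rfl
      exact ⟨hwT, hw⟩

theorem IsCritical.linearIndependent_clique {V : Type*} [Fintype V] [DecidableEq V]
    {G : SimpleGraph V} [DecidableRel G.Adj] {k : ℕ} (hG : IsCritical G k) (hk : 2 ≤ k) :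
    LinearIndependent ℚ
      (fun (T : G.cliqueFinset (k - 1)) (v : V) => if v ∈ T.1 then (1 : ℚ) else 0) := by
  refine linearIndependent_indicator_of_pair_distinguished (m := k - 1) (by omega) _
    (fun T hT => (mem_cliqueFinset_iff.mp hT).card_eq) fun T hT x hx y hy hxy => ?_
  obtain ⟨A, -, hA⟩ := hG.exists_finset_card_inter (by omega)
    ((mem_cliqueFinset_iff.mp hT).isClique hx hy hxy)
  exact ⟨A, fun T hT => hA T (mem_cliqueFinset_iff.mp hT)⟩

open Finset in
/-- A function summing to zero over each member of a family of `|V|` sets with linearly independent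
indicator vectors vanishes. -/
theorem eq_zero_of_sum_eq_zero_of_linearIndependent {V : Type*} [Fintype V] [DecidableEq V]
    {𝒯 : Finset (Finset V)}
    (hli : LinearIndependent ℚ (fun (T : 𝒯) (v : V) => if v ∈ T.1 then (1 : ℚ) else 0))
    (hcard : #𝒯 = Fintype.card V) {f : V → ℚ} (hf : ∀ T ∈ 𝒯, ∑ v ∈ T, f v = 0) : f = 0 := by
  have hspan := hli.span_eq_top_of_card_eq_finrank' (by simpa using hcard)
  have hzero : Fintype.linearCombination ℚ f = 0 := by
    refine LinearMap.ext_on_range hspan fun T => ?_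
    simpa [Fintype.linearCombination_apply] using hf T.1 T.2
  ext v
  simpa using congrArg (fun g => g (Pi.single v 1)) hzero

open Finset in
/-- A `k`-critical graph with as many `(k - 1)`-cliques as vertices is `(k - 1)`-regular. -/
theorem IsCritical.isRegularOfDegree {V : Type*} [Fintype V] [DecidableEq V]
    {G : SimpleGraph V} [DecidableRel G.Adj] {k : ℕ} (hG : IsCritical G k) (hk : 3 ≤ k)
    (hcard : #(G.cliqueFinset (k - 1)) = Fintype.card V) : G.IsRegularOfDegree (k - 1) := by
  intro x
  have hA : ∀ y, ∃ A : Finset V, G.Adj x y → x ∈ A ∧ ∀ T, G.IsNClique (k - 1) T →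
      #(T ∩ A) = 1 + if x ∈ T ∧ y ∈ T then 1 else 0 := by
    intro y
    by_cases hxy : G.Adj x y
    · obtain ⟨A, hA⟩ := hG.exists_finset_card_inter (by omega) hxy
      exact ⟨A, fun _ => hA⟩
    · exact ⟨∅, fun h => absurd h hxy⟩
  choose A hA using hA
  obtain ⟨m, rfl⟩ : ∃ m, k = m + 2 := ⟨k - 2, by omega⟩
  simp only [show m + 2 - 1 = m + 1 by omega] at *
  have hm : (m : ℚ) + 1 ≠ 0 := by positivity
  have hf := eq_zero_of_sum_eq_zero_of_linearIndependent (f := fun v =>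
    ∑ y ∈ G.neighborFinset x, ((if v ∈ A y then (1 : ℚ) else 0) - 1 / (m + 1)) -
      if v = x then (m : ℚ) else 0) (hG.linearIndependent_clique (by omega)) hcard ?_
  · have hx := congrFun hf x
    simp only [if_true, Pi.zero_apply] at hx
    rw [sum_congr rfl fun y hy => by
      rw [if_pos (hA y ((mem_neighborFinset _ _ _).mp hy)).1]] at hx
    rw [sum_const, card_neighborFinset_eq_degree, nsmul_eq_mul] at hx
    field_simp at hx
    have hm' : (m : ℚ) ≠ 0 := by
      norm_cast
      omega
    have : (G.degree x : ℚ) = m + 1 := by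
      apply mul_left_cancel₀ hm'
      linarith
    exact_mod_cast this
  · intro T hT
    rw [mem_cliqueFinset_iff] at hT
    have hT' : G.IsNClique (m + 1) T := hT
    rw [sum_sub_distrib, sum_comm]
    have hy : ∀ y ∈ G.neighborFinset x,
        ∑ v ∈ T, ((if v ∈ A y then (1 : ℚ) else 0) - 1 / (m + 1)) =
          if x ∈ T ∧ y ∈ T then 1 else 0 := by
      intro y hy
      have := (hA y ((mem_neighborFinset _ _ _).mp hy)).2 T hT'
      rw [sum_sub_distrib, sum_boole, filter_mem_eq_inter, this, sum_const, hT'.card_eq]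
      push_cast
      rw [nsmul_eq_mul]
      push_cast
      field_simp
      ring
    rw [sum_congr rfl hy, sum_ite_eq' T x]
    by_cases hx : x ∈ T
    · have : G.neighborFinset x ∩ T = T.erase x := by
        ext v
        simp only [mem_inter, mem_neighborFinset, mem_erase]
        exact ⟨fun h => ⟨h.1.ne', h.2⟩, fun h => ⟨hT'.isClique hx h.2 h.1.symm, h.2⟩⟩
      simp [hx, this, card_erase_of_mem, hT'.card_eq]
    · simp [hx]

open Finset in
/-- If three cliques of size `d` contain a vertex of degree `d`, then the closed neighborhood of
that vertex is a clique. -/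
theorem isNClique_insert_neighborFinset {V : Type*} [Fintype V] [DecidableEq V]
    {G : SimpleGraph V} [DecidableRel G.Adj] {d : ℕ} {x : V} (hdeg : G.degree x = d)
    (h : 2 < #((G.cliqueFinset d).filter (x ∈ ·))) :
    G.IsNClique (d + 1) (insert x (G.neighborFinset x)) := by
  set K := insert x (G.neighborFinset x) with hK
  have hKcard : #K = d + 1 := by
    rw [hK, card_insert_of_notMem (by simp), card_neighborFinset_eq_degree, hdeg]
  have herase : ∀ T ∈ (G.cliqueFinset d).filter (x ∈ ·), G.IsClique T ∧ ∃ a, T = K.erase a := by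
    intro T hT
    rw [mem_filter, mem_cliqueFinset_iff] at hT
    obtain ⟨hT, hxT⟩ := hT
    have hTK : T ⊆ K := by
      intro v hv
      by_cases hvx : v = x
      · simp [hK, hvx]
      · simpa [hK, hvx] using hT.isClique hxT hv (Ne.symm hvx)
    obtain ⟨a, haK, haT⟩ := exists_mem_notMem_of_card_lt_card (s := T) (t := K)
      (by rw [hT.card_eq, hKcard]; omega)
    refine ⟨hT.isClique, a, eq_of_subset_of_card_le (subset_erase.mpr ⟨hTK, haT⟩) ?_⟩
    rw [card_erase_of_mem haK, hKcard, hT.card_eq]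
    omega
  obtain ⟨T₁, h₁, T₂, h₂, T₃, h₃, h₁₂, h₁₃, h₂₃⟩ := two_lt_card.mp h
  obtain ⟨hc₁, a₁, rfl⟩ := herase T₁ h₁
  obtain ⟨hc₂, a₂, rfl⟩ := herase T₂ h₂
  obtain ⟨hc₃, a₃, rfl⟩ := herase T₃ h₃
  have ha₁₂ : a₁ ≠ a₂ := fun h => h₁₂ (by rw [h])
  have ha₁₃ : a₁ ≠ a₃ := fun h => h₁₃ (by rw [h])
  have ha₂₃ : a₂ ≠ a₃ := fun h => h₂₃ (by rw [h])
  refine ⟨fun p hp q hq hpq => ?_, hKcard⟩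
  have hmem (a : V) (hc : G.IsClique (K.erase a : Finset V)) (hpa : p ≠ a) (hqa : q ≠ a) :
      G.Adj p q :=
    hc (by exact_mod_cast mem_erase.mpr ⟨hpa, hp⟩) (by exact_mod_cast mem_erase.mpr ⟨hqa, hq⟩) hpq
  obtain h | h | h : (p ≠ a₁ ∧ q ≠ a₁) ∨ (p ≠ a₂ ∧ q ≠ a₂) ∨ (p ≠ a₃ ∧ q ≠ a₃) := by
    clear * - ha₁₂ ha₁₃ ha₂₃
    grind
  · exact hmem a₁ hc₁ h.1 h.2
  · exact hmem a₂ hc₂ h.1 h.2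
  · exact hmem a₃ hc₃ h.1 h.2

/-- A `k`-critical graph containing a `k`-clique consists of that clique. -/
theorem IsCritical.eq_univ_of_isNClique {V : Type*} [Fintype V] {G : SimpleGraph V} {k : ℕ}
    (hG : IsCritical G k) (hk : 0 < k) {K : Finset V} (hK : G.IsNClique k K) :
    K = Finset.univ := by
  by_contra hne
  have hH : (⊤ : G.Subgraph).induce (K : Set V) ≠ ⊤ := by
    intro h
    apply hne
    have := congrArg Subgraph.verts h
    simpa using this
  have hle := IsClique.card_le_of_colorable (s := K.attach)
    (G := ((⊤ : G.Subgraph).induce (K : Set V)).coe) ?_ (hG.colorable_coe hH)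
  · have hcard := K.card_attach.trans hK.card_eq
    exact absurd (hcard.symm.le.trans hle) (by omega)
  · intro u _ v _ huv
    have huv' : (u : V) ≠ v := fun h => huv (Subtype.ext h)
    simpa using ⟨u.2, v.2, hK.isClique u.2 v.2 huv'⟩

/-- Gallai's conjecture (Stiebitz, Abbott–Zhou): every `k`-critical graph on `n`
vertices (`k ≥ 4`) has at most `n` copies of `K_{k-1}`, with equality only if
`n = k` and `G` is the complete graph `K_n`. -/
theorem gallai_conjecture {V : Type*} [Fintype V] {n k : ℕ} (hk : 4 ≤ k)
    (hcard : Fintype.card V = n) (G : SimpleGraph V) (hG : IsCritical G k) :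
    cliqueCount G (k - 1) ≤ n ∧
      (cliqueCount G (k - 1) = n → n = k ∧ Nonempty (G ≃g completeGraph (Fin n))) := by
  classical
  have hcount : cliqueCount G (k - 1) = (G.cliqueFinset (k - 1)).card := by
    rw [← Set.ncard_coe_finset, coe_cliqueFinset]
    rfl
  subst hcard
  rw [hcount]
  refine ⟨?_, fun heq => ?_⟩
  · have hle := (hG.linearIndependent_clique (by omega)).fintype_card_le_finrank
    rwa [Fintype.card_coe, Module.finrank_fintype_fun_eq_card] at hle
  have hreg := hG.isRegularOfDegree (by omega) heq
  obtain ⟨x, hx⟩ : ∃ x : V, 2 < ((G.cliqueFinset (k - 1)).filter (x ∈ ·)).card := by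
    by_contra! hle
    have hV : 0 < Fintype.card V := by
      rw [Fintype.card_pos_iff]
      by_contra hV
      rw [not_nonempty_iff] at hV
      exact hG.not_colorable (by omega) (.of_isEmpty _)
    have hdouble : (G.cliqueFinset (k - 1)).card * (k - 1) ≤ Fintype.card V * 2 := by
      calc _ = ∑ T ∈ G.cliqueFinset (k - 1), T.card := by
            rw [Finset.sum_const_nat fun T hT => (mem_cliqueFinset_iff.mp hT).card_eq]
        _ = ∑ x : V, ((G.cliqueFinset (k - 1)).filter (x ∈ ·)).card := by
            simp only [Finset.card_filter]
            rw [Finset.sum_comm]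
            simp
        _ ≤ _ := by
            simpa using Finset.sum_le_card_nsmul Finset.univ _ 2 fun x _ => hle x
    rw [heq] at hdouble
    have := Nat.le_of_mul_le_mul_left hdouble hV
    omega
  have hK := isNClique_insert_neighborFinset (hreg x) hx
  rw [Nat.sub_add_cancel (by omega)] at hK
  rw [hG.eq_univ_of_isNClique (by omega) hK] at hK
  have hG_top : G = ⊤ := by
    ext u v
    exact ⟨fun h => h.ne, fun h => hK.isClique (by simp) (by simp) h⟩
  refine ⟨by simpa using hK.card_eq, ?_⟩
  rw [hG_top]
  exact ⟨Iso.completeGraph (Fintype.equivFin V)⟩
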